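/- Suppose φ is Sturmian and of unbounded type (every vertex has an infinite type set). Then for every vertex x, the vertices of the 1-ball around x realize at most three distinct type sets: the set {Λ(y) : y ∈ V(T), d(x,y) ≤ 1} has at most three elements. -/

import Mathlib

open SimpleGraph

/-- Equivalence of colored `n`-balls around `x` and `y`: a graph isomorphism between the
induced subgraphs on the balls, sending center to center and preserving the coloring. -/
def BallEquiv {V A : Type*} (T : SimpleGraph V) (φ : V → A) (n : ℕ) (x y : V) : Prop :=
  ∃ f : {v : V // T.dist x v ≤ n} ≃ {v : V // T.dist y v ≤ n},
    ((f ⟨x, by simp [SimpleGraph.dist_self]⟩ : {v : V // T.dist y v ≤ n}) : V) = y ∧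
    (∀ u w : {v : V // T.dist x v ≤ n}, T.Adj (u : V) (w : V) ↔ T.Adj (f u : V) (f w : V)) ∧
    ∀ v : {v : V // T.dist x v ≤ n}, φ (f v : V) = φ (v : V)

/-- Two vertices are in the same class if a color-preserving automorphism of `T`
sends one to the other. -/
def SameClass {V A : Type*} (T : SimpleGraph V) (φ : V → A) (x y : V) : Prop :=
  ∃ g : V ≃ V, (∀ u w : V, T.Adj (g u) (g w) ↔ T.Adj u w) ∧ g x = y ∧ ∀ v, φ (g v) = φ v

/-- Subword complexity: the number of equivalence classes of colored `n`-balls. -/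
noncomputable def ballComplexity {V A : Type*} (T : SimpleGraph V) (φ : V → A) (n : ℕ) : ℕ :=
  Nat.card (Quot (BallEquiv T φ n))

/-- A coloring is periodic if it is invariant under a subgroup of the automorphism group
of `T` having finitely many orbits on vertices. -/
def IsPeriodicColoring {V A : Type*} (T : SimpleGraph V) (φ : V → A) : Prop :=
  ∃ Γ : Subgroup (Equiv.Perm V),
    (∀ γ ∈ Γ, ∀ u w : V, T.Adj (γ u) (γ w) ↔ T.Adj u w) ∧
    (∀ γ ∈ Γ, ∀ v, φ (γ v) = φ v) ∧
    Finite (Quot (fun x y : V => ∃ γ ∈ Γ, γ x = y))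

/-- The colored `n`-ball around `x` is special. -/
def IsSpecial {V A : Type*} (T : SimpleGraph V) (φ : V → A) (n : ℕ) (x : V) : Prop :=
  ∃ y z : V, BallEquiv T φ n x y ∧ BallEquiv T φ n x z ∧ ¬ BallEquiv T φ (n + 1) y z

/-- The type set of a vertex. -/
def TypeSet {V A : Type*} (T : SimpleGraph V) (φ : V → A) (x : V) : Set ℕ :=
  {n : ℕ | IsSpecial T φ n x}

/-- The maximal type of a vertex of bounded type (`-1` if the type set is empty). -/
noncomputable def maxType {V A : Type*} (T : SimpleGraph V) (φ : V → A) (x : V) : ℤ :=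
  sSup (insert (-1) ((fun n : ℕ => (n : ℤ)) '' TypeSet T φ x))

/-- The coloring is Sturmian if its subword complexity is `n + 2`. -/
def IsSturmian {V A : Type*} (T : SimpleGraph V) (φ : V → A) : Prop :=
  ∀ n : ℕ, ballComplexity T φ n = n + 2

/-- Eventually periodic coloring. -/
def IsEventuallyPeriodic {V A : Type*} (T : SimpleGraph V) (φ : V → A) : Prop :=
  ∃ K : Set V, K.Nonempty ∧ K.Finite ∧ (T.induce K).Connected ∧
    ∀ v : (Kᶜ : Set V), ∃ ψ : V → A, IsPeriodicColoring T ψ ∧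
      ∀ w : (Kᶜ : Set V), (T.induce (Kᶜ : Set V)).Reachable v w → ψ (w : V) = φ (w : V)

/-- The vertex set of the `n`-branch from `x` towards its neighbor `x'`. -/
def branchSet {V : Type*} (T : SimpleGraph V) (n : ℕ) (x x' : V) : Set V :=
  insert x {y : V | T.dist x y ≤ n ∧ T.dist y x' < T.dist y x}

/-- Equivalence of colored `n`-branches. -/
def BranchEquiv {V A : Type*} (T : SimpleGraph V) (φ : V → A) (n : ℕ)
    (x x' y y' : V) : Prop :=
  ∃ f : (branchSet T n x x') ≃ (branchSet T n y y'),
    ((f ⟨x, Set.mem_insert x _⟩ : (branchSet T n y y')) : V) = y ∧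
    (∀ u w : (branchSet T n x x'), T.Adj (u : V) (w : V) ↔ T.Adj (f u : V) (f w : V)) ∧
    ∀ v : (branchSet T n x x'), φ (f v : V) = φ (v : V)

/-- A coloring of `K` appears exactly once if the only connected subgraph of `T`
color-isomorphic to it is `K` itself. -/
def AppearsOnce {V A : Type*} (T : SimpleGraph V) (φ : V → A) (K : Set V) : Prop :=
  ∀ K' : Set V, (T.induce K').Connected →
    (∃ f : K ≃ K', (∀ u w : K, T.Adj (u : V) (w : V) ↔ T.Adj (f u : V) (f w : V)) ∧
      ∀ v : K, φ (f v : V) = φ (v : V)) → K' = K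

section BallEquivalence

variable {V A : Type*} {T : SimpleGraph V} {φ : V → A}

/-- A color isomorphism of balls sends a walk staying inside the ball to a walk of the same
length, so distances bounded by the remaining radius do not increase. -/
lemma SimpleGraph.dist_ballMap_le (hT : T.Connected) {m n : ℕ} {x y : V}
    (f : {v : V // T.dist x v ≤ m} → {v : V // T.dist y v ≤ m})
    (hf : ∀ u w : {v : V // T.dist x v ≤ m}, T.Adj (u : V) (w : V) → T.Adj (f u : V) (f w : V))
    (u w : {v : V // T.dist x v ≤ m}) (hu : T.dist x u + n ≤ m) (hw : T.dist u w ≤ n) :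
    T.dist (f u : V) (f w : V) ≤ n := by
  induction n generalizing u with
  | zero =>
    have huw : u = w := Subtype.ext ((hT.dist_eq_zero_iff).1 (by omega))
    simp [huw]
  | succ n ih =>
    obtain ⟨p, hp⟩ := hT.exists_walk_length_eq_dist (u : V) (w : V)
    obtain ⟨u, hu'⟩ := u
    obtain ⟨w, hw'⟩ := w
    cases p with
    | nil => simp
    | @cons _ v _ h q =>
      have hxv : T.dist x v ≤ T.dist x u + 1 :=
        (hT.dist_triangle (v := u)).trans_eq (by rw [dist_eq_one_iff_adj.2 h])
      have hq : T.dist v w ≤ n := by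
        refine (dist_le q).trans ?_
        simp only [Walk.length_cons] at hp hw
        omega
      have hvm : T.dist x v ≤ m := by simp only at hu; omega
      have h₁ := ih ⟨v, hvm⟩ (by simp only at hu ⊢; omega) hq
      have h₂ := dist_eq_one_iff_adj.2 (hf ⟨u, hu'⟩ ⟨v, hvm⟩ h)
      have h₃ := hT.dist_triangle (u := (f ⟨u, hu'⟩ : V)) (v := (f ⟨v, hvm⟩ : V))
        (w := (f ⟨w, hw'⟩ : V))
      omega

lemma BallEquiv.refl (n : ℕ) (x : V) : BallEquiv T φ n x x :=
  ⟨Equiv.refl _, rfl, fun _ _ => Iff.rfl, fun _ => rfl⟩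

lemma BallEquiv.symm {n : ℕ} {x y : V} (h : BallEquiv T φ n x y) : BallEquiv T φ n y x := by
  obtain ⟨f, hxy, hadj, hcol⟩ := h
  refine ⟨f.symm, ?_, fun u w => ?_, fun v => ?_⟩
  · have : f.symm ⟨y, by simp⟩ = ⟨x, by simp⟩ := by
      rw [Equiv.symm_apply_eq]
      exact Subtype.ext hxy.symm
    rw [this]
  · rw [hadj, f.apply_symm_apply, f.apply_symm_apply]
  · rw [← hcol, f.apply_symm_apply]

lemma BallEquiv.trans {n : ℕ} {x y z : V} (h : BallEquiv T φ n x y) (h' : BallEquiv T φ n y z) :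
    BallEquiv T φ n x z := by
  obtain ⟨f, hxy, hadj, hcol⟩ := h
  obtain ⟨g, hyz, gadj, gcol⟩ := h'
  refine ⟨f.trans g, ?_, fun u w => ?_, fun v => ?_⟩
  · have : f ⟨x, by simp⟩ = ⟨y, by simp⟩ := Subtype.ext hxy
    simpa [this] using hyz
  · rw [hadj, gadj]
    rfl
  · rw [← hcol, ← gcol]
    rfl

lemma ballEquiv_equivalence (n : ℕ) : Equivalence (BallEquiv T φ n) :=
  ⟨BallEquiv.refl n, BallEquiv.symm, BallEquiv.trans⟩

/-- A color isomorphism of balls restricts to smaller balls around vertices inside. -/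
lemma ballEquiv_of_isometric_restrict (hT : T.Connected) {m n : ℕ} {x y : V}
    (f : {v : V // T.dist x v ≤ m} ≃ {v : V // T.dist y v ≤ m})
    (hadj : ∀ u w : {v : V // T.dist x v ≤ m}, T.Adj (u : V) (w : V) ↔ T.Adj (f u : V) (f w : V))
    (hcol : ∀ v, φ (f v : V) = φ (v : V)) (z : {v : V // T.dist x v ≤ m})
    (hz : T.dist x z + n ≤ m) (hfz : T.dist y (f z) + n ≤ m) :
    BallEquiv T φ n (z : V) (f z : V) := by
  have hxm (v : V) (hv : T.dist (z : V) v ≤ n) : T.dist x v ≤ m := by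
    have := hT.dist_triangle (u := x) (v := z) (w := v)
    omega
  have hym (v : V) (hv : T.dist (f z : V) v ≤ n) : T.dist y v ≤ m := by
    have := hT.dist_triangle (u := y) (v := f z) (w := v)
    omega
  have hsymm (u w : {v : V // T.dist y v ≤ m}) (h : T.Adj (u : V) (w : V)) :
      T.Adj (f.symm u : V) (f.symm w : V) := by
    rwa [hadj, f.apply_symm_apply, f.apply_symm_apply]
  refine ⟨⟨fun v => ⟨f ⟨v, hxm v v.2⟩, ?_⟩, fun v => ⟨f.symm ⟨v, hym v v.2⟩, ?_⟩,
    fun v => ?_, fun v => ?_⟩, rfl,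
    fun u w => hadj ⟨u, hxm u u.2⟩ ⟨w, hxm w w.2⟩, fun v => hcol ⟨v, hxm v v.2⟩⟩
  · exact dist_ballMap_le hT f (fun u w => (hadj u w).1) z ⟨v, _⟩ hz v.2
  · have := dist_ballMap_le hT f.symm hsymm (f z) ⟨v, hym v v.2⟩ hfz v.2
    rwa [f.symm_apply_apply] at this
  · simp
  · simp

lemma BallEquiv.of_succ (hT : T.Connected) {n : ℕ} {x y : V} (h : BallEquiv T φ (n + 1) x y) :
    BallEquiv T φ n x y := by
  obtain ⟨f, hxy, hadj, hcol⟩ := h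
  have := ballEquiv_of_isometric_restrict (n := n) hT f hadj hcol ⟨x, by simp⟩ (by simp)
    (by rw [hxy]; simp)
  rwa [hxy] at this

lemma BallEquiv.mono (hT : T.Connected) {m n : ℕ} (hmn : m ≤ n) {x y : V}
    (h : BallEquiv T φ n x y) : BallEquiv T φ m x y := by
  induction n, hmn using Nat.le_induction with
  | base => exact h
  | succ n _ ih => exact ih (h.of_succ hT)

lemma BallEquiv.exists_adj (hT : T.Connected) {n : ℕ} {x y z : V}
    (h : BallEquiv T φ (n + 1) x y) (hz : T.Adj x z) : ∃ w, T.Adj y w ∧ BallEquiv T φ n z w := by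
  obtain ⟨f, hxy, hadj, hcol⟩ := h
  have hxz := dist_eq_one_iff_adj.2 hz
  have hyz := (hadj ⟨x, by simp⟩ ⟨z, by omega⟩).1 hz
  rw [hxy] at hyz
  refine ⟨_, hyz, ballEquiv_of_isometric_restrict hT f hadj hcol ⟨z, by omega⟩ ?_ ?_⟩
  · simp only
    omega
  · rw [dist_eq_one_iff_adj.2 hyz, add_comm]

lemma BallEquiv.isSpecial {n : ℕ} {x y : V} (h : BallEquiv T φ n x y) (hx : IsSpecial T φ n x) :
    IsSpecial T φ n y := by
  obtain ⟨u, w, hu, hw, huw⟩ := hx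
  exact ⟨u, w, h.symm.trans hu, h.symm.trans hw, huw⟩

lemma BallEquiv.succ_of_not_isSpecial {n : ℕ} {x y : V} (h : BallEquiv T φ n x y)
    (hx : ¬ IsSpecial T φ n x) : BallEquiv T φ (n + 1) x y := by
  by_contra hxy
  exact hx ⟨x, y, .refl n x, h, hxy⟩

lemma IsSpecial.exists_not_ballEquiv_succ {n : ℕ} {x : V} (hx : IsSpecial T φ n x) :
    ∃ y, BallEquiv T φ n x y ∧ ¬ BallEquiv T φ (n + 1) x y := by
  obtain ⟨u, w, hu, hw, huw⟩ := hx
  by_cases h : BallEquiv T φ (n + 1) x u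
  · exact ⟨w, hw, fun h' => huw (h.symm.trans h')⟩
  · exact ⟨u, hu, h⟩

lemma exists_not_ballEquiv_of_typeSet_ne {x y : V} (h : TypeSet T φ x ≠ TypeSet T φ y) :
    ∃ n, ¬ BallEquiv T φ n x y := by
  contrapose! h
  ext n
  exact ⟨(h n).isSpecial, (h n).symm.isSpecial⟩

/-- A Sturmian coloring has at most one special `n`-ball. -/
lemma IsSturmian.ballEquiv_of_isSpecial (hT : T.Connected) (hst : IsSturmian T φ) {n : ℕ}
    {x y : V} (hx : IsSpecial T φ n x) (hy : IsSpecial T φ n y) : BallEquiv T φ n x y := by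
  by_contra hxy
  obtain ⟨x', hx', hxx'⟩ := hx.exists_not_ballEquiv_succ
  obtain ⟨y', hy', hyy'⟩ := hy.exists_not_ballEquiv_succ
  have eq_iff (m : ℕ) (a b : V) :
      Quot.mk (BallEquiv T φ m) a = Quot.mk _ b ↔ BallEquiv T φ m a b := by
    rw [Quot.eq, (ballEquiv_equivalence m).eqvGen_iff]
  have card_succ : Nat.card (Quot (BallEquiv T φ (n + 1))) = n + 3 := hst (n + 1)
  have card_n : Nat.card (Quot (BallEquiv T φ n)) = n + 2 := hst n
  have : Finite (Quot (BallEquiv T φ (n + 1))) := Nat.finite_of_card_ne_zero (by omega)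
  let π : Quot (BallEquiv T φ (n + 1)) → Quot (BallEquiv T φ n) :=
    Quot.map id fun _ _ h => h.of_succ hT
  let s : Set (Quot (BallEquiv T φ (n + 1))) := {Quot.mk _ x', Quot.mk _ y'}
  have hs : s.ncard = 2 := Set.ncard_pair fun h =>
    hxy ((hx'.trans (((eq_iff _ _ _).1 h).of_succ hT)).trans hy'.symm)
  have himage : π '' sᶜ = Set.univ := by
    refine Set.eq_univ_of_forall fun q => ?_
    induction q using Quot.ind with
    | mk a =>
    by_cases hax : BallEquiv T φ (n + 1) a x'
    · refine ⟨Quot.mk _ x, ?_, (eq_iff _ _ _).2 (hx'.trans (hax.of_succ hT).symm)⟩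
      simp only [s, Set.mem_compl_iff, Set.mem_insert_iff, Set.mem_singleton_iff, eq_iff, not_or]
      exact ⟨hxx', fun h => hxy ((h.of_succ hT).trans hy'.symm)⟩
    by_cases hay : BallEquiv T φ (n + 1) a y'
    · refine ⟨Quot.mk _ y, ?_, (eq_iff _ _ _).2 (hy'.trans (hay.of_succ hT).symm)⟩
      simp only [s, Set.mem_compl_iff, Set.mem_insert_iff, Set.mem_singleton_iff, eq_iff, not_or]
      exact ⟨fun h => hxy (hx'.trans (h.of_succ hT).symm), hyy'⟩
    · refine ⟨Quot.mk _ a, ?_, rfl⟩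
      simp only [s, Set.mem_compl_iff, Set.mem_insert_iff, Set.mem_singleton_iff, eq_iff, not_or]
      exact ⟨hax, hay⟩
  have h₁ : (π '' sᶜ).ncard ≤ sᶜ.ncard := Set.ncard_image_le (Set.toFinite _)
  rw [himage, Set.ncard_univ, card_n] at h₁
  have h₂ := Set.ncard_add_ncard_compl s
  omega

/-- When the ball of `x` splits between radii `n + 1` and `n + 2`, a neighbor `y` that is not
special nearby sees both parts. -/
lemma IsSturmian.exists_adj_split (hT : T.Connected) (hst : IsSturmian T φ) {n : ℕ} {x y : V}
    (hadj : T.Adj x y) (hx : IsSpecial T φ (n + 1) x) (hxy : ¬ BallEquiv T φ (n + 1) x y)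
    (hy : ¬ IsSpecial T φ n y) (hy' : ¬ IsSpecial T φ (n + 2) y) :
    ∃ w, T.Adj y w ∧ BallEquiv T φ (n + 1) x w ∧ ¬ BallEquiv T φ (n + 2) x w := by
  obtain ⟨x', hx', hxx'⟩ := hx.exists_not_ballEquiv_succ
  obtain ⟨y', hadj', hyy'⟩ := hx'.exists_adj hT hadj
  have h₁ := (hyy'.succ_of_not_isSpecial hy).succ_of_not_isSpecial
    fun h => hxy (hst.ballEquiv_of_isSpecial hT hx h)
  obtain ⟨w, hw, hw'⟩ := (h₁.succ_of_not_isSpecial hy').symm.exists_adj hT hadj'.symm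
  exact ⟨w, hw, hx'.trans (hw'.of_succ hT), fun h => hxx' (h.trans hw'.symm)⟩

/-- The neighbors of `y` whose `n`-ball is equivalent to that of `x`. -/
def neighborsEquiv (T : SimpleGraph V) (φ : V → A) (x y : V) (n : ℕ) : Set V :=
  {w | T.Adj y w ∧ BallEquiv T φ n x w}

lemma antitone_ncard_neighborsEquiv (hT : T.Connected) (x : V) {y : V}
    (hfin : (T.neighborSet y).Finite) : Antitone fun n => (neighborsEquiv T φ x y n).ncard :=
  fun _ _ hmn => Set.ncard_le_ncard (fun _ hw => ⟨hw.1, hw.2.mono hT hmn⟩)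
    (hfin.subset fun _ hw => hw.1)

lemma IsSturmian.ncard_neighborsEquiv_lt (hT : T.Connected) (hst : IsSturmian T φ) {n : ℕ}
    {x y : V} (hfin : (T.neighborSet y).Finite) (hadj : T.Adj x y)
    (hx : IsSpecial T φ (n + 1) x) (hxy : ¬ BallEquiv T φ (n + 1) x y)
    (hy : ¬ IsSpecial T φ n y) (hy' : ¬ IsSpecial T φ (n + 2) y) :
    (neighborsEquiv T φ x y (n + 2)).ncard < (neighborsEquiv T φ x y (n + 1)).ncard := by
  obtain ⟨w, hw, h₁, h₂⟩ := hst.exists_adj_split hT hadj hx hxy hy hy'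
  refine Set.ncard_lt_ncard ⟨fun v hv => ⟨hv.1, hv.2.of_succ hT⟩, fun h => ?_⟩
    (hfin.subset fun _ hv => hv.1)
  exact h₂ (h ⟨hw, h₁⟩).2

/-- A vertex of infinite type cannot have three neighbors such that the three neighbors and the
vertex itself have four distinct balls of some radius. -/
lemma IsSturmian.false_of_three_neighbors (hT : T.Connected) (hst : IsSturmian T φ)
    (hfin : ∀ v, (T.neighborSet v).Finite) {x a b c : V} (hx : (TypeSet T φ x).Infinite)
    (ha : T.Adj x a) (hb : T.Adj x b) (hc : T.Adj x c) {N : ℕ}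
    (hxa : ¬ BallEquiv T φ N x a) (hxb : ¬ BallEquiv T φ N x b) (hxc : ¬ BallEquiv T φ N x c)
    (hab : ¬ BallEquiv T φ N a b) (hac : ¬ BallEquiv T φ N a c) (hbc : ¬ BallEquiv T φ N b c) :
    False := by
  let g (n : ℕ) : ℕ := (neighborsEquiv T φ x a n).ncard + (neighborsEquiv T φ x b n).ncard +
    (neighborsEquiv T φ x c n).ncard
  have hga := antitone_ncard_neighborsEquiv (φ := φ) hT x (hfin a)
  have hgb := antitone_ncard_neighborsEquiv (φ := φ) hT x (hfin b)
  have hgc := antitone_ncard_neighborsEquiv (φ := φ) hT x (hfin c)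
  have hg : Antitone g := (hga.add hgb).add hgc
  obtain ⟨m, hm⟩ : ∃ m, ∀ n, g m ≤ g n :=
    ⟨Function.argmin g, fun n => Function.argmin_le g n⟩
  obtain ⟨n', hn', hlt⟩ := hx.exists_gt (max N m)
  obtain ⟨n, rfl⟩ : ∃ n, n' = n + 1 := ⟨n' - 1, by omega⟩
  have hN : N ≤ n := by omega
  have not_both {u v : V} (huv : ¬ BallEquiv T φ N u v) {l : ℕ} (hl : N ≤ l) :
      ¬ (IsSpecial T φ l u ∧ IsSpecial T φ l v) := fun h =>
    huv ((hst.ballEquiv_of_isSpecial hT h.1 h.2).mono hT hl)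
  have key {y : V} (hy : T.Adj x y) (hxy : ¬ BallEquiv T φ N x y) (h₁ : ¬ IsSpecial T φ n y)
      (h₂ : ¬ IsSpecial T φ (n + 2) y) :=
    hst.ncard_neighborsEquiv_lt hT (hfin y) hy hn' (fun h => hxy (h.mono hT (by omega))) h₁ h₂
  have h₁ := hga (Nat.le_succ (n + 1))
  have h₂ := hgb (Nat.le_succ (n + 1))
  have h₃ := hgc (Nat.le_succ (n + 1))
  have h₄ := hm (n + 2)
  have h₅ := hg (show m ≤ n + 1 by omega)
  have hge : g (n + 1) ≤ g (n + 2) := h₅.trans h₄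
  simp only [g] at hge
  simp only [Nat.succ_eq_add_one, add_assoc, Nat.reduceAdd] at h₁ h₂ h₃ hge
  have ka := key ha hxa
  have kb := key hb hxb
  have kc := key hc hxc
  have nab := not_both hab hN
  have nac := not_both hac hN
  have nbc := not_both hbc hN
  have nab' := not_both hab (show N ≤ n + 2 by omega)
  have nac' := not_both hac (show N ≤ n + 2 by omega)
  have nbc' := not_both hbc (show N ≤ n + 2 by omega)
  by_cases sa : IsSpecial T φ n a ∨ IsSpecial T φ (n + 2) a
  · by_cases sb : IsSpecial T φ n b ∨ IsSpecial T φ (n + 2) b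
    · have := kc (fun sc => by grind) (fun sc => by grind)
      omega
    · rw [not_or] at sb
      have := kb sb.1 sb.2
      omega
  · rw [not_or] at sa
    have := ka sa.1 sa.2
    omega

end BallEquivalence

theorem stmt_18 {V A : Type*} (T : SimpleGraph V) (φ : V → A) (k : ℕ)
    (hk : 2 ≤ k) (htree : T.IsTree) (hreg : ∀ v : V, (T.neighborSet v).ncard = k)
    (hst : IsSturmian T φ) (hub : ∀ v : V, (TypeSet T φ v).Infinite) (x : V) :
    ∃ s : Finset (Set ℕ), s.card ≤ 3 ∧
      ∀ y : V, T.dist x y ≤ 1 → TypeSet T φ y ∈ s := by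
  classical
  have hT := htree.connected
  have hfin (v : V) : (T.neighborSet v).Finite :=
    Set.finite_of_ncard_ne_zero (by rw [hreg]; omega)
  let t : Finset (Set ℕ) := ((hfin x).toFinset.image (TypeSet T φ)).erase (TypeSet T φ x)
  refine ⟨insert (TypeSet T φ x) t, ?_, fun y hy => ?_⟩
  · refine (Finset.card_insert_le _ _).trans (Nat.succ_le_succ ?_)
    by_contra! hcard
    obtain ⟨p, q, r, hp, hq, hr, hpq, hpr, hqr⟩ := Finset.two_lt_card_iff.1 hcard
    simp only [t, Finset.mem_erase, Finset.mem_image, Set.Finite.mem_toFinset,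
      mem_neighborSet] at hp hq hr
    obtain ⟨hxa, a, ha, rfl⟩ := hp
    obtain ⟨hxb, b, hb, rfl⟩ := hq
    obtain ⟨hxc, c, hc, rfl⟩ := hr
    obtain ⟨n₁, h₁⟩ := exists_not_ballEquiv_of_typeSet_ne hxa.symm
    obtain ⟨n₂, h₂⟩ := exists_not_ballEquiv_of_typeSet_ne hxb.symm
    obtain ⟨n₃, h₃⟩ := exists_not_ballEquiv_of_typeSet_ne hxc.symm
    obtain ⟨n₄, h₄⟩ := exists_not_ballEquiv_of_typeSet_ne hpq
    obtain ⟨n₅, h₅⟩ := exists_not_ballEquiv_of_typeSet_ne hpr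
    obtain ⟨n₆, h₆⟩ := exists_not_ballEquiv_of_typeSet_ne hqr
    exact hst.false_of_three_neighbors (N := n₁ + n₂ + n₃ + n₄ + n₅ + n₆) hT hfin (hub x) ha hb hc
      (fun h => h₁ (h.mono hT (by omega))) (fun h => h₂ (h.mono hT (by omega)))
      (fun h => h₃ (h.mono hT (by omega))) (fun h => h₄ (h.mono hT (by omega)))
      (fun h => h₅ (h.mono hT (by omega))) (fun h => h₆ (h.mono hT (by omega)))
  · by_cases hxy : TypeSet T φ y = TypeSet T φ x
    · simp [hxy]
    · refine Finset.mem_insert_of_mem (Finset.mem_erase.2 ⟨hxy, Finset.mem_image_of_mem _ ?_⟩)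
      have hne : T.dist x y ≠ 0 := fun h => hxy (by rw [hT.dist_eq_zero_iff.1 h])
      simpa using dist_eq_one_iff_adj.1 (show T.dist x y = 1 by omega)
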